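/- Let I ⊆ S, let a ≥ 1 be an integer and q = p^a, let u, v ∈ U^I, and let w^(0), …, w^(a−1) ∈ ℕ^{n+2} each be a nonnegative integral combination of a_1^+, …, a_N^+, with Σ_{i=0}^{a−1} p^i·w^(i) = q·u − v in ℤ^{n+2}. Then there exist w̃^(0), w̃^(1), …, w̃^(a) ∈ U^I such that w̃^(0) = v, w̃^(a) = u, and w^(i) = p·w̃^(i+1) − w̃^(i) for all i = 0, …, a−1. -/

import Mathlib

/-- `a_j⁺ = (a_{0j}, …, a_{nj}, 1) ∈ ℕ^{n+2}`. -/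
def aplus {n N : ℕ} (a : Fin N → Fin (n + 1) → ℕ) (j : Fin N) : Fin (n + 2) → ℕ :=
  Fin.snoc (a j) 1

/-- Induction on the number of steps: peel off `w⁽⁰⁾`, replacing `v` by `(w⁽⁰⁾ + v) / p`. -/
theorem tilde_aux (p n d : ℕ) (hp : 0 < p) (I : Finset (Fin (n + 1)))
    (u : Fin (n + 2) → ℕ) (s : ℕ) :
    ∀ (v : Fin (n + 2) → ℕ)
    (_ : (∑ i : Fin (n + 1), v i.castSucc = d * v (Fin.last (n + 1))) ∧
      ∀ i ∈ I, 0 < v i.castSucc)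
    (w : Fin s → Fin (n + 2) → ℕ)
    (_ : ∀ i : Fin s, ∑ c : Fin (n + 1), w i c.castSucc = d * w i (Fin.last (n + 1)))
    (_ : ∀ c : Fin (n + 2),
      ∑ i : Fin s, (p : ℤ) ^ (i : ℕ) * (w i c : ℤ) = (p : ℤ) ^ s * u c - v c),
    ∃ wt : Fin (s + 1) → Fin (n + 2) → ℕ,
      wt 0 = v ∧ wt (Fin.last s) = u ∧
      (∀ i : Fin (s + 1),
        (∑ c : Fin (n + 1), wt i c.castSucc = d * wt i (Fin.last (n + 1))) ∧
        ∀ c ∈ I, 0 < wt i c.castSucc) ∧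
      (∀ i : Fin s, ∀ c : Fin (n + 2),
        (w i c : ℤ) = p * wt i.succ c - wt i.castSucc c) := by
  induction s with
  | zero =>
    intro v hv w hw hsum
    refine ⟨fun _ => v, rfl, ?_, fun _ => hv, fun i => i.elim0⟩
    funext c
    have h := hsum c
    simp at h
    change v c = u c
    omega
  | succ s ih =>
    intro v hv w hw hsum
    have hdiv : ∀ c, ∃ k : ℕ, w 0 c + v c = p * k := by
      intro c
      have h := hsum c
      rw [Fin.sum_univ_succ] at h
      have hd : (p : ℤ) ∣ ((w 0 c + v c : ℕ) : ℤ) := by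
        refine ⟨(p : ℤ) ^ s * u c - ∑ i : Fin s, (p : ℤ) ^ (i : ℕ) * (w i.succ c : ℤ), ?_⟩
        rw [mul_sub, Finset.mul_sum]
        simp only [Fin.val_succ, pow_succ', Fin.val_zero, pow_zero, one_mul, mul_assoc] at h
        push_cast
        linarith
      exact_mod_cast hd
    choose v' hv' using hdiv
    have hU : (∑ i : Fin (n + 1), v' i.castSucc = d * v' (Fin.last (n + 1))) ∧
        ∀ i ∈ I, 0 < v' i.castSucc := by
      constructor
      · apply Nat.eq_of_mul_eq_mul_left hp
        rw [Finset.mul_sum]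
        simp only [← hv']
        rw [Finset.sum_add_distrib, hw 0, hv.1, ← mul_add, hv']
        ring
      · intro i hi
        have h1 := hv.2 i hi
        have h2 := hv' i.castSucc
        rcases Nat.eq_zero_or_pos (v' i.castSucc) with h | h
        · rw [h] at h2
          omega
        · exact h
    obtain ⟨wt, h0, hl, hI, hrec⟩ := ih v' hU (fun i => w i.succ) (fun i => hw i.succ) (by
      intro c
      have h := hsum c
      rw [Fin.sum_univ_succ] at h
      have h2 : (w 0 c : ℤ) + v c = p * v' c := by exact_mod_cast hv' c
      have hp' : (p : ℤ) ≠ 0 := by exact_mod_cast hp.ne'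
      apply mul_left_cancel₀ hp'
      rw [mul_sub, Finset.mul_sum]
      simp only [Fin.val_succ, pow_succ', Fin.val_zero, pow_zero, one_mul, mul_assoc] at h
      linarith)
    refine ⟨Fin.cons v wt, by simp, ?_, ?_, ?_⟩
    · rw [← Fin.succ_last, Fin.cons_succ, hl]
    · intro i
      refine Fin.cases ?_ (fun i => ?_) i
      · simpa using hv
      · simpa using hI i
    · intro i c
      refine Fin.cases ?_ (fun i => ?_) i
      · have h2 : (w 0 c : ℤ) + v c = p * v' c := by exact_mod_cast hv' c
        rw [Fin.cons_succ, h0, Fin.castSucc_zero, Fin.cons_zero]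
        linarith
      · rw [Fin.cons_succ, ← Fin.succ_castSucc, Fin.cons_succ]
        exact hrec i c

/-- construction (3.17): given `u, v ∈ U^I`, `q = p^s`, and
`w⁽⁰⁾, …, w⁽ˢ⁻¹⁾ ∈ ℕA` with `∑ᵢ pⁱ w⁽ⁱ⁾ = q·u − v` in `ℤ^{n+2}`, there exist
`w̃⁽⁰⁾, …, w̃⁽ˢ⁾ ∈ U^I` with `w̃⁽⁰⁾ = v`, `w̃⁽ˢ⁾ = u`, and
`w⁽ⁱ⁾ = p·w̃⁽ⁱ⁺¹⁾ − w̃⁽ⁱ⁾` for all `i`. -/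
theorem stmt_5 (p n N d : ℕ) (hp : p.Prime) (hn : 1 ≤ n) (hN : 1 ≤ N) (hd : 2 ≤ d)
    (a : Fin N → Fin (n + 1) → ℕ) (ha : ∀ j, ∑ i, a j i = d)
    (I : Finset (Fin (n + 1)))
    (s : ℕ) (hs : 1 ≤ s)
    (u v : Fin (n + 2) → ℕ)
    (hu : (∑ i : Fin (n + 1), u i.castSucc = d * u (Fin.last (n + 1))) ∧
      ∀ i ∈ I, 0 < u i.castSucc)
    (hv : (∑ i : Fin (n + 1), v i.castSucc = d * v (Fin.last (n + 1))) ∧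
      ∀ i ∈ I, 0 < v i.castSucc)
    (w : Fin s → Fin (n + 2) → ℕ)
    (hw : ∀ i : Fin s, ∃ ν : Fin N → ℕ, ∀ c : Fin (n + 2), w i c = ∑ j, ν j * aplus a j c)
    (hsum : ∀ c : Fin (n + 2),
      ∑ i : Fin s, (p : ℤ) ^ (i : ℕ) * (w i c : ℤ) = (p : ℤ) ^ s * u c - v c) :
    ∃ wt : Fin (s + 1) → Fin (n + 2) → ℕ,
      wt 0 = v ∧ wt (Fin.last s) = u ∧
      (∀ i : Fin (s + 1),
        (∑ c : Fin (n + 1), wt i c.castSucc = d * wt i (Fin.last (n + 1))) ∧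
        ∀ c ∈ I, 0 < wt i c.castSucc) ∧
      (∀ i : Fin s, ∀ c : Fin (n + 2),
        (w i c : ℤ) = p * wt i.succ c - wt i.castSucc c) := by
  refine tilde_aux p n d hp.pos I u s v hv w ?_ hsum
  intro i
  obtain ⟨ν, hν⟩ := hw i
  simp only [hν, aplus, Fin.snoc_castSucc, Fin.snoc_last]
  rw [Finset.sum_comm, Finset.mul_sum]
  refine Finset.sum_congr rfl fun j _ => ?_
  rw [← Finset.mul_sum, ha j]
  ring
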